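/- For any n ≥ 1, Σ_{σ ∈ S_n(231)} q^{mak(σ)} t^{des(σ)} = Σ_{σ ∈ S_n(231)} q^{FOZE6(σ)} t^{des(σ)}, where FOZE6(σ) := (21-3)σ + (3-21)σ + (13-2)σ + des(σ); that is, the statistic FOZE6 is equidistributed jointly with des against mak over 231-avoiding permutations. -/

import Mathlib

namespace MahonianStats

open Finset

/-- The value sequence of a permutation of `{1,…,n}`: position `i` (0-indexed)
carries the value `σ(i+1) ∈ {1,…,n}`; positions `≥ n` carry the junk value `0`. -/
def pf {n : ℕ} (σ : Equiv.Perm (Fin n)) : ℕ → ℕ :=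
  fun i => if h : i < n then ((σ ⟨i, h⟩ : Fin n) : ℕ) + 1 else 0

/-- The value sequence of a list (junk value `0` out of range). -/
def lf (l : List ℕ) : ℕ → ℕ := fun i => l.getD i 0

/-- Descent positions (0-indexed). -/
def desSet (n : ℕ) (f : ℕ → ℕ) : Finset ℕ :=
  (range (n - 1)).filter fun i => f (i + 1) < f i

def des (n : ℕ) (f : ℕ → ℕ) : ℕ := (desSet n f).card

/-- Major index: sum of (1-indexed) descent positions. -/
def maj (n : ℕ) (f : ℕ → ℕ) : ℕ := ∑ i ∈ desSet n f, (i + 1)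

/-- Occurrences of the vincular pattern (1-32). -/
def p1_32 (n : ℕ) (f : ℕ → ℕ) : ℕ :=
  ((range n ×ˢ range n).filter fun p =>
    p.1 < p.2 ∧ p.2 + 1 < n ∧ f p.1 < f (p.2 + 1) ∧ f (p.2 + 1) < f p.2).card

/-- Occurrences of the vincular pattern (31-2). -/
def p31_2 (n : ℕ) (f : ℕ → ℕ) : ℕ :=
  ((range n ×ˢ range n).filter fun p =>
    p.1 + 1 < p.2 ∧ f (p.1 + 1) < f p.2 ∧ f p.2 < f p.1).card

/-- Occurrences of the vincular pattern (32-1). -/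
def p32_1 (n : ℕ) (f : ℕ → ℕ) : ℕ :=
  ((range n ×ˢ range n).filter fun p =>
    p.1 + 1 < p.2 ∧ f p.2 < f (p.1 + 1) ∧ f (p.1 + 1) < f p.1).card

/-- Occurrences of the vincular pattern (21-3). -/
def p21_3 (n : ℕ) (f : ℕ → ℕ) : ℕ :=
  ((range n ×ˢ range n).filter fun p =>
    p.1 + 1 < p.2 ∧ f (p.1 + 1) < f p.1 ∧ f p.1 < f p.2).card

/-- Occurrences of the vincular pattern (3-21). -/
def p3_21 (n : ℕ) (f : ℕ → ℕ) : ℕ :=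
  ((range n ×ˢ range n).filter fun p =>
    p.1 < p.2 ∧ p.2 + 1 < n ∧ f (p.2 + 1) < f p.2 ∧ f p.2 < f p.1).card

/-- Occurrences of the vincular pattern (13-2). -/
def p13_2 (n : ℕ) (f : ℕ → ℕ) : ℕ :=
  ((range n ×ˢ range n).filter fun p =>
    p.1 + 1 < p.2 ∧ f p.1 < f p.2 ∧ f p.2 < f (p.1 + 1)).card

/-- Occurrences of the vincular pattern (2-13). -/
def p2_13 (n : ℕ) (f : ℕ → ℕ) : ℕ :=
  ((range n ×ˢ range n).filter fun p =>
    p.1 < p.2 ∧ p.2 + 1 < n ∧ f p.2 < f p.1 ∧ f p.1 < f (p.2 + 1)).card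

/-- Occurrences of the vincular pattern (2-31). -/
def p2_31 (n : ℕ) (f : ℕ → ℕ) : ℕ :=
  ((range n ×ˢ range n).filter fun p =>
    p.1 < p.2 ∧ p.2 + 1 < n ∧ f (p.2 + 1) < f p.1 ∧ f p.1 < f p.2).card

/-- Number of inversions. -/
def invp (n : ℕ) (f : ℕ → ℕ) : ℕ :=
  ((range n ×ˢ range n).filter fun p => p.1 < p.2 ∧ f p.2 < f p.1).card

def mak (n : ℕ) (f : ℕ → ℕ) : ℕ := p1_32 n f + p31_2 n f + p32_1 n f + des n f

def mad (n : ℕ) (f : ℕ → ℕ) : ℕ := 2 * p2_31 n f + p31_2 n f + des n f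

def Av123 (n : ℕ) (f : ℕ → ℕ) : Prop :=
  ¬ ∃ i j k, i < j ∧ j < k ∧ k < n ∧ f i < f j ∧ f j < f k
def Av132 (n : ℕ) (f : ℕ → ℕ) : Prop :=
  ¬ ∃ i j k, i < j ∧ j < k ∧ k < n ∧ f i < f k ∧ f k < f j
def Av213 (n : ℕ) (f : ℕ → ℕ) : Prop :=
  ¬ ∃ i j k, i < j ∧ j < k ∧ k < n ∧ f j < f i ∧ f i < f k
def Av231 (n : ℕ) (f : ℕ → ℕ) : Prop :=
  ¬ ∃ i j k, i < j ∧ j < k ∧ k < n ∧ f k < f i ∧ f i < f j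
def Av312 (n : ℕ) (f : ℕ → ℕ) : Prop :=
  ¬ ∃ i j k, i < j ∧ j < k ∧ k < n ∧ f j < f k ∧ f k < f i
def Av321 (n : ℕ) (f : ℕ → ℕ) : Prop :=
  ¬ ∃ i j k, i < j ∧ j < k ∧ k < n ∧ f k < f j ∧ f j < f i

/-- The Mahonian statistic `(21-3) + (3-21) + (13-2) + des`. -/
def foze6 (n : ℕ) (f : ℕ → ℕ) : ℕ := p21_3 n f + p3_21 n f + p13_2 n f + des n f

section algebra

open Finset

variable {R : Type*} [CommSemiring R]

lemma sum_anti_assoc (n : ℕ) (f : ℕ → ℕ → ℕ → R) :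
    ∑ p ∈ antidiagonal n, ∑ r ∈ antidiagonal p.1, f r.1 r.2 p.2 =
    ∑ p ∈ antidiagonal n, ∑ r ∈ antidiagonal p.2, f p.1 r.1 r.2 := by
  rw [Finset.sum_sigma', Finset.sum_sigma']
  refine Finset.sum_bij' (fun x _ => ⟨(x.2.1, x.2.2 + x.1.2), (x.2.2, x.1.2)⟩)
    (fun x _ => ⟨(x.1.1 + x.2.1, x.2.2), (x.1.1, x.2.1)⟩) ?_ ?_ ?_ ?_ ?_
  · rintro ⟨⟨a, b⟩, ⟨c, d⟩⟩ h
    simp only [mem_sigma, HasAntidiagonal.mem_antidiagonal] at h ⊢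
    obtain ⟨h1, h2⟩ := h
    refine ⟨?_, trivial⟩
    omega
  · rintro ⟨⟨a, b⟩, ⟨c, d⟩⟩ h
    simp only [mem_sigma, HasAntidiagonal.mem_antidiagonal] at h ⊢
    obtain ⟨h1, h2⟩ := h
    refine ⟨?_, trivial⟩
    omega
  · rintro ⟨⟨a, b⟩, ⟨c, d⟩⟩ h
    simp only [mem_sigma, HasAntidiagonal.mem_antidiagonal] at h ⊢
    obtain ⟨h1, rfl⟩ := h
    rfl
  · rintro ⟨⟨a, b⟩, ⟨c, d⟩⟩ h
    simp only [mem_sigma, HasAntidiagonal.mem_antidiagonal] at h ⊢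
    obtain ⟨h1, rfl⟩ := h
    rfl
  · rintro ⟨⟨a, b⟩, ⟨c, d⟩⟩ h
    rfl

def wt (q t : R) (a m : ℕ) : R := if a = 0 then 1 else t * q ^ m

lemma wt_succ (q t : R) (a m : ℕ) : wt q t (a + 1) m = t * q ^ m := by simp [wt]
lemma wt_zero (q t : R) (m : ℕ) : wt q t 0 m = 1 := by simp [wt]

/-- Recurrence `A` (first entry) from recurrence `B` (largest entry). -/
lemma recA (q t : R) (M : ℕ → ℕ → R) (h0 : ∀ e, M 0 e = 1)
    (hB : ∀ n e, M (n + 1) e =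
      ∑ p ∈ antidiagonal n, M p.1 e * (wt q t p.2 (e + n) * M p.2 (e + p.1))) :
    ∀ n e, M (n + 1) e =
      ∑ p ∈ antidiagonal n, wt q t p.1 (e + p.1) * M p.1 e * M p.2 (e + p.1 + 1) := by
  intro n
  induction n using Nat.strong_induction_on with
  | _ n ih =>
  intro e
  rw [hB]
  cases n with
  | zero => simp [h0]
  | succ n =>
    rw [Finset.Nat.sum_antidiagonal_succ, Finset.Nat.sum_antidiagonal_succ']
    refine congrArg₂ _ ?_ ?_
    · simp [h0]
    · have key := sum_anti_assoc n (fun a b d =>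
        wt q t a (e + a) * M a e * (M b (e + a + 1) * (wt q t d (e + (n + 1)) * M d (e + a + b + 1))))
      calc _ = ∑ p ∈ antidiagonal n, ∑ r ∈ antidiagonal p.1, wt q t r.1 (e + r.1) * M r.1 e *
              (M r.2 (e + r.1 + 1) * (wt q t p.2 (e + (n + 1)) * M p.2 (e + r.1 + r.2 + 1))) := by
            refine Finset.sum_congr rfl fun p hp => ?_
            rw [HasAntidiagonal.mem_antidiagonal] at hp
            rw [ih p.1 (by omega), Finset.sum_mul]
            refine Finset.sum_congr rfl fun r hr => ?_
            rw [HasAntidiagonal.mem_antidiagonal] at hr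
            rw [show e + r.1 + r.2 + 1 = e + (p.1 + 1) by omega]
            ring
        _ = _ := key
        _ = _ := by
            refine Finset.sum_congr rfl fun p hp => ?_
            rw [HasAntidiagonal.mem_antidiagonal] at hp
            rw [hB, Finset.mul_sum]
            refine Finset.sum_congr rfl fun r hr => ?_
            rw [HasAntidiagonal.mem_antidiagonal] at hr
            rw [show e + p.1 + 1 + p.2 = e + (n+1) by omega,
              show e + p.1 + 1 + r.1 = e + p.1 + r.1 + 1 by omega]

lemma recD (q t : R) (M : ℕ → ℕ → R) (h0 : ∀ e, M 0 e = 1)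
    (hA : ∀ n e, M (n + 1) e =
      ∑ p ∈ antidiagonal n, wt q t p.1 (e + p.1) * M p.1 e * M p.2 (e + p.1 + 1)) :
    ∀ s e, ∑ p ∈ antidiagonal s, q ^ p.1 * M (p.1 + 1) e * M p.2 (e + p.1 + 2) =
      ∑ p ∈ antidiagonal s, q ^ p.1 * M p.1 (e + 1) * M (p.2 + 1) (e + p.1 + 1) := by
  intro s
  induction s using Nat.strong_induction_on with
  | _ s ih =>
  intro e
  have hA' : ∀ n e, M (n + 2) e = M (n + 1) (e + 1) +
      ∑ p ∈ antidiagonal n, t * q ^ (e + p.1 + 1) * M (p.1 + 1) e * M p.2 (e + p.1 + 2) := by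
    intro n e
    rw [hA, Finset.Nat.sum_antidiagonal_succ]
    simp only [wt_zero, wt_succ, h0]
    simp only [add_zero, one_mul]
    congr 1
  cases s with
  | zero => simp [h0, hA, wt]
  | succ s =>
    rw [Finset.Nat.sum_antidiagonal_succ, Finset.Nat.sum_antidiagonal_succ']
    simp only [hA', mul_add, add_mul, Finset.sum_add_distrib]
    have e1 : M 1 e = 1 := by simp [hA, h0, wt]
    have e2 : M 1 (e + (s + 1) + 1) = 1 := by simp [hA, h0, wt]
    have k1 : ∑ x ∈ antidiagonal s, q ^ (x.1 + 1) *
          (∑ p ∈ antidiagonal x.1, t * q ^ (e + p.1 + 1) * M (p.1 + 1) e * M p.2 (e + p.1 + 2)) *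
          M x.2 (e + (x.1 + 1) + 2) =
        ∑ x ∈ antidiagonal s, q ^ x.1 * M x.1 (e + 1) *
          (∑ p ∈ antidiagonal x.2, t * q ^ (e + x.1 + 1 + p.1 + 1) *
            M (p.1 + 1) (e + x.1 + 1) * M p.2 (e + x.1 + 1 + p.1 + 2)) := by
      have key := sum_anti_assoc s (fun a b d => t * q ^ (e + a + b + 2) * (q ^ a * M a (e + 1) *
        M (b + 1) (e + a + 1)) * M d (e + a + b + 3))
      calc _ = ∑ p ∈ antidiagonal s, ∑ r ∈ antidiagonal p.1, t * q ^ (e + r.1 + r.2 + 2) *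
            (q ^ r.1 * M r.1 (e + 1) * M (r.2 + 1) (e + r.1 + 1)) * M p.2 (e + r.1 + r.2 + 3) := by
            refine Finset.sum_congr rfl fun p hp => ?_
            rw [HasAntidiagonal.mem_antidiagonal] at hp
            have h := ih p.1 (by omega) e
            calc _ = t * q ^ (e + p.1 + 2) * (∑ r ∈ antidiagonal p.1,
                  q ^ r.1 * M (r.1 + 1) e * M r.2 (e + r.1 + 2)) * M p.2 (e + p.1 + 3) := by
                  rw [Finset.mul_sum, Finset.mul_sum, Finset.sum_mul, Finset.sum_mul]
                  refine Finset.sum_congr rfl fun r hr => ?_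
                  rw [show e + (p.1 + 1) + 2 = e + p.1 + 3 by omega]
                  ring
              _ = _ := by
                  rw [h, Finset.mul_sum, Finset.sum_mul]
                  refine Finset.sum_congr rfl fun r hr => ?_
                  rw [HasAntidiagonal.mem_antidiagonal] at hr
                  rw [← hr, add_assoc e r.1 r.2]
        _ = _ := key
        _ = _ := by
            refine Finset.sum_congr rfl fun p hp => ?_
            rw [Finset.mul_sum]
            refine Finset.sum_congr rfl fun r hr => ?_
            rw [show e + p.1 + 1 + r.1 + 2 = e + p.1 + r.1 + 3 by omega]
            ring
    rw [k1]
    have k2 : q ^ 0 * M (0 + 1) e * M (s + 1) (e + 0 + 2) +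
        ∑ x ∈ antidiagonal s, q ^ (x.1 + 1) * M (x.1 + 1) (e + 1) * M x.2 (e + (x.1 + 1) + 2) =
        ∑ x ∈ antidiagonal s, q ^ x.1 * M x.1 (e + 1) * M (x.2 + 1) (e + x.1 + 1 + 1) +
          q ^ (s + 1) * M (s + 1) (e + 1) * M (0 + 1) (e + (s + 1) + 1) := by
      have l := Finset.Nat.sum_antidiagonal_succ (n := s)
        (f := fun x => q ^ x.1 * M x.1 (e + 1) * M x.2 (e + x.1 + 2))
      have r := Finset.Nat.sum_antidiagonal_succ' (n := s)
        (f := fun x => q ^ x.1 * M x.1 (e + 1) * M x.2 (e + x.1 + 2))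
      rw [l] at r
      simp only [h0, zero_add, e1, e2, mul_one] at r ⊢
      simp only [pow_zero, one_mul] at r ⊢
      rw [r, add_comm]
    rw [← add_assoc, k2]
    ring

lemma recC (q t : R) (M : ℕ → ℕ → R) (h0 : ∀ e, M 0 e = 1)
    (hB : ∀ n e, M (n + 1) e =
      ∑ p ∈ antidiagonal n, M p.1 e * (wt q t p.2 (e + n) * M p.2 (e + p.1))) :
    ∀ n e, M (n + 1) e =
      ∑ p ∈ antidiagonal n, wt q 1 p.1 p.2 * wt q t p.2 (e + 1) *
        M p.1 (e + p.2 + 1) * M p.2 (e + 1) := by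
  have hA := recA q t M h0 hB
  have hD := recD q t M h0 hA
  intro n e
  cases n with
  | zero => simp [hA, h0, wt]
  | succ n =>
    have h := hD n e
    have e1 : ∑ p ∈ antidiagonal n, wt q t (p.1 + 1) (e + (p.1 + 1)) * M (p.1 + 1) e *
        M p.2 (e + (p.1 + 1) + 1) = t * q ^ (e + 1) *
        ∑ p ∈ antidiagonal n, q ^ p.1 * M (p.1 + 1) e * M p.2 (e + p.1 + 2) := by
      rw [Finset.mul_sum]
      refine Finset.sum_congr rfl fun p hp => ?_
      rw [wt_succ, show e + (p.1 + 1) + 1 = e + p.1 + 2 by omega]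
      ring
    have hs : ∀ f : ℕ → ℕ → R, ∑ p ∈ antidiagonal (n+1), f p.1 p.2 =
        ∑ p ∈ antidiagonal (n+1), f p.2 p.1 := fun f =>
      (Finset.Nat.sum_antidiagonal_swap (n := n + 1) (f := fun p => f p.2 p.1))
    rw [hA, Finset.Nat.sum_antidiagonal_succ, e1, h,
      hs (fun a b => wt q 1 a b * wt q t b (e + 1) * M a (e + b + 1) * M b (e + 1))]
    rw [Finset.Nat.sum_antidiagonal_succ']
    cases n with
    | zero =>
      simp [wt_zero, wt_succ, h0]
      ring
    | succ m =>
      rw [Finset.Nat.sum_antidiagonal_succ, Finset.Nat.sum_antidiagonal_succ]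
      simp only [wt_zero, wt_succ, h0, mul_add, Finset.mul_sum]
      rw [← add_assoc, ← add_assoc]
      congr 1
      · simp; ring
      · refine Finset.sum_congr rfl fun p hp => ?_
        ring

lemma rec_unique (q t : R) (M F : ℕ → ℕ → R) (h0 : ∀ e, M 0 e = 1) (h0' : ∀ e, F 0 e = 1)
    (hB : ∀ n e, M (n + 1) e =
      ∑ p ∈ antidiagonal n, M p.1 e * (wt q t p.2 (e + n) * M p.2 (e + p.1)))
    (hC : ∀ n e, F (n + 1) e =
      ∑ p ∈ antidiagonal n, wt q 1 p.1 p.2 * wt q t p.2 (e + 1) *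
        F p.1 (e + p.2 + 1) * F p.2 (e + 1)) : ∀ n e, M n e = F n e := by
  have hM := recC q t M h0 hB
  intro n
  induction n using Nat.strong_induction_on with
  | _ n ih =>
  intro e
  cases n with
  | zero => rw [h0, h0']
  | succ n =>
    rw [hM, hC]
    refine Finset.sum_congr rfl fun p hp => ?_
    rw [HasAntidiagonal.mem_antidiagonal] at hp
    rw [ih p.1 (by omega), ih p.2 (by omega)]

end algebra
section stats

/-- `h` is obtained by gluing `f` (length `a`), the maximum, and `g` shifted by `a` (length `b`). -/
structure Glued (a b : ℕ) (f g h : ℕ → ℕ) : Prop where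
  hL : ∀ i < a, h i = f i
  hM : h a = a + b + 1
  hR : ∀ i < b, h (a + 1 + i) = g i + a
  fb : ∀ i < a, 1 ≤ f i ∧ f i ≤ a
  gb : ∀ i < b, 1 ≤ g i ∧ g i ≤ b

variable {a b : ℕ} {f g h : ℕ → ℕ}

lemma Glued.factL (H : Glued a b f g h) (i : ℕ) (hi : i ∈ range a) :
    i < a ∧ h i = f i ∧ 1 ≤ f i ∧ f i ≤ a ∧
      ((i + 1 < a ∧ h (i + 1) = f (i + 1) ∧ 1 ≤ f (i + 1) ∧ f (i + 1) ≤ a) ∨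
        (i + 1 = a ∧ h (i + 1) = a + b + 1)) := by
  rw [mem_range] at hi
  refine ⟨hi, H.hL i hi, (H.fb i hi).1, (H.fb i hi).2, ?_⟩
  by_cases h1 : i + 1 < a
  · exact Or.inl ⟨h1, H.hL _ h1, (H.fb _ h1).1, (H.fb _ h1).2⟩
  · have : i + 1 = a := by omega
    refine Or.inr ⟨this, ?_⟩
    rw [this, H.hM]

lemma Glued.factR (H : Glued a b f g h) (i : ℕ) (hi : i ∈ range b) :
    i < b ∧ h (a + 1 + i) = g i + a ∧ 1 ≤ g i ∧ g i ≤ b ∧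
      ((i + 1 < b ∧ h (a + 1 + i + 1) = g (i + 1) + a ∧ 1 ≤ g (i + 1) ∧ g (i + 1) ≤ b) ∨
        (i + 1 = b)) := by
  rw [mem_range] at hi
  refine ⟨hi, H.hR i hi, (H.gb i hi).1, (H.gb i hi).2, ?_⟩
  by_cases h1 : i + 1 < b
  · exact Or.inl ⟨h1, H.hR _ h1, (H.gb _ h1).1, (H.gb _ h1).2⟩
  · exact Or.inr (by omega)

lemma Glued.factM (H : Glued a b f g h) :
    h a = a + b + 1 ∧ ((0 < b ∧ h (a + 1) = g 0 + a ∧ 1 ≤ g 0 ∧ g 0 ≤ b) ∨ b = 0) := by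
  refine ⟨H.hM, ?_⟩
  by_cases h1 : 0 < b
  · exact Or.inl ⟨h1, H.hR 0 h1, (H.gb _ h1).1, (H.gb _ h1).2⟩
  · exact Or.inr (by omega)

lemma split9 (a b : ℕ) (c : ℕ → ℕ → ℕ) :
    ∑ i ∈ range (a + 1 + b), ∑ k ∈ range (a + 1 + b), c i k =
      (∑ i ∈ range a, ∑ k ∈ range a, c i k + ∑ i ∈ range a, c i a +
        ∑ i ∈ range a, ∑ k ∈ range b, c i (a + 1 + k)) +
      (∑ k ∈ range a, c a k + c a a + ∑ k ∈ range b, c a (a + 1 + k)) +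
      (∑ i ∈ range b, ∑ k ∈ range a, c (a + 1 + i) k + ∑ i ∈ range b, c (a + 1 + i) a +
        ∑ i ∈ range b, ∑ k ∈ range b, c (a + 1 + i) (a + 1 + k)) := by
  simp only [Finset.sum_range_add, Finset.sum_range_succ, Finset.sum_add_distrib]
  ring

lemma blocks (a b : ℕ) (c cL cR LR : ℕ → ℕ → ℕ) (LM MR : ℕ → ℕ)
    (h0 : ∀ i k, k ≤ i → c i k = 0)
    (hLL : ∀ i ∈ range a, ∀ k ∈ range a, c i k = cL i k)
    (hLM : ∀ i ∈ range a, c i a = LM i)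
    (hLR : ∀ i ∈ range a, ∀ k ∈ range b, c i (a + 1 + k) = LR i k)
    (hMR : ∀ k ∈ range b, c a (a + 1 + k) = MR k)
    (hRR : ∀ i ∈ range b, ∀ k ∈ range b, c (a + 1 + i) (a + 1 + k) = cR i k) :
    ∑ i ∈ range (a + 1 + b), ∑ k ∈ range (a + 1 + b), c i k =
      ∑ i ∈ range a, ∑ k ∈ range a, cL i k + ∑ i ∈ range b, ∑ k ∈ range b, cR i k +
      ∑ i ∈ range a, LM i + ∑ i ∈ range a, ∑ k ∈ range b, LR i k + ∑ k ∈ range b, MR k := by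
  rw [split9, Finset.sum_congr rfl fun i hi => Finset.sum_congr rfl (hLL i hi),
    Finset.sum_congr rfl hLM, Finset.sum_congr rfl fun i hi => Finset.sum_congr rfl (hLR i hi),
    Finset.sum_congr rfl hMR,
    Finset.sum_congr rfl fun i hi => Finset.sum_congr rfl (hRR i hi), h0 a a le_rfl,
    Finset.sum_eq_zero (s := range a) (f := fun k => c a k)
      (fun k hk => h0 _ _ (mem_range.1 hk).le),
    Finset.sum_eq_zero (s := range b) (f := fun i => ∑ k ∈ range a, c (a + 1 + i) k)
      (fun i hi => Finset.sum_eq_zero fun k hk => h0 _ _ (by have := mem_range.1 hk; omega)),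
    Finset.sum_eq_zero (s := range b) (f := fun i => c (a + 1 + i) a)
      (fun i hi => h0 _ _ (by omega))]
  ring

lemma des_eq (n : ℕ) (f : ℕ → ℕ) :
    des n f = ∑ i ∈ range n, if i + 1 < n ∧ f (i + 1) < f i then 1 else 0 := by
  unfold des desSet
  rw [← Finset.card_filter]
  congr 1
  ext i
  simp only [mem_filter, mem_range]
  omega

lemma card_pairs (n : ℕ) (P : ℕ → ℕ → Prop) [∀ i k, Decidable (P i k)] :
    ((range n ×ˢ range n).filter fun p => P p.1 p.2).card =
      ∑ i ∈ range n, ∑ k ∈ range n, if P i k then 1 else 0 := by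
  rw [Finset.card_filter, Finset.sum_product]

lemma des_glue (H : Glued a b f g h) :
    des (a + 1 + b) h = des a f + des b g + (if b = 0 then 0 else 1) := by
  have hM := H.factM
  simp only [des_eq, Finset.sum_range_add (n := a + 1), Finset.sum_range_succ]
  have h1 : ∀ i ∈ range a, (if i + 1 < a + 1 + b ∧ h (i + 1) < h i then 1 else 0) =
      (if i + 1 < a ∧ f (i + 1) < f i then 1 else 0) := by
    intro i hi
    have := H.factL i hi
    split_ifs <;> omega
  have h2 : ∀ i ∈ range b, (if a + 1 + i + 1 < a + 1 + b ∧ h (a + 1 + i + 1) < h (a + 1 + i)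
      then 1 else 0) = (if i + 1 < b ∧ g (i + 1) < g i then 1 else 0) := by
    intro i hi
    have := H.factR i hi
    split_ifs <;> omega
  have h3 : (if a + 1 < a + 1 + b ∧ h (a + 1) < h a then 1 else 0) = (if b = 0 then 0 else 1) := by
    split_ifs <;> omega
  rw [Finset.sum_congr rfl h1, Finset.sum_congr rfl h2, h3]
  ring

lemma p1_32_eq (n : ℕ) (f : ℕ → ℕ) : p1_32 n f = ∑ i ∈ range n, ∑ k ∈ range n,
    if i < k ∧ k + 1 < n ∧ f i < f (k + 1) ∧ f (k + 1) < f k then 1 else 0 :=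
  card_pairs n (fun i k => i < k ∧ k + 1 < n ∧ f i < f (k + 1) ∧ f (k + 1) < f k)

lemma p1_32_glue (H : Glued a b f g h) :
    p1_32 (a + 1 + b) h = p1_32 a f + p1_32 b g + (a * des b g + (if b = 0 then 0 else a)) := by
  have hM := H.factM
  rw [p1_32_eq, blocks a b _
    (fun i k => if i < k ∧ k + 1 < a ∧ f i < f (k + 1) ∧ f (k + 1) < f k then 1 else 0)
    (fun i k => if i < k ∧ k + 1 < b ∧ g i < g (k + 1) ∧ g (k + 1) < g k then 1 else 0)
    (fun _ k => if k + 1 < b ∧ g (k + 1) < g k then 1 else 0)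
    (fun _ => if b = 0 then 0 else 1)
    0
    (fun i k hik => if_neg (by omega)) ?_ ?_ ?_ ?_ ?_, ← p1_32_eq, ← p1_32_eq]
  · simp only [des_eq, Finset.sum_const, card_range, smul_eq_mul, Pi.zero_apply]
    split_ifs <;> ring
  · intro i hi k hk
    have := H.factL i hi
    have := H.factL k hk
    split_ifs <;> omega
  · intro i hi
    have := H.factL i hi
    try simp only [Pi.zero_apply]
    split_ifs <;> omega
  · intro i hi k hk
    have := H.factL i hi
    have := H.factR k hk
    try simp only [Pi.zero_apply]
    split_ifs <;> omega
  · intro k hk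
    have := H.factR k hk
    try simp only [Pi.zero_apply]
    split_ifs <;> omega
  · intro i hi k hk
    have := H.factR i hi
    have := H.factR k hk
    split_ifs <;> omega

lemma p31_2_eq (n : ℕ) (f : ℕ → ℕ) : p31_2 n f = ∑ i ∈ range n, ∑ k ∈ range n,
    if i + 1 < k ∧ f (i + 1) < f k ∧ f k < f i then 1 else 0 :=
  card_pairs n (fun i k => i + 1 < k ∧ f (i + 1) < f k ∧ f k < f i)

lemma p31_2_glue (H : Glued a b f g h) :
    p31_2 (a + 1 + b) h = p31_2 a f + p31_2 b g + (∑ k ∈ range b, (if 0 < k ∧ g 0 < g k then 1 else 0)) := by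
  have hM := H.factM
  rw [p31_2_eq, blocks a b _
    (fun i k => if i + 1 < k ∧ f (i + 1) < f k ∧ f k < f i then 1 else 0)
    (fun i k => if i + 1 < k ∧ g (i + 1) < g k ∧ g k < g i then 1 else 0)
    0
    0
    (fun k => if 0 < k ∧ g 0 < g k then 1 else 0)
    (fun i k hik => if_neg (by omega)) ?_ ?_ ?_ ?_ ?_, ← p31_2_eq, ← p31_2_eq]
  · simp
  · intro i hi k hk
    have := H.factL i hi
    have := H.factL k hk
    split_ifs <;> omega
  · intro i hi
    have := H.factL i hi
    try simp only [Pi.zero_apply]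
    split_ifs <;> omega
  · intro i hi k hk
    have := H.factL i hi
    have := H.factR k hk
    try simp only [Pi.zero_apply]
    split_ifs <;> omega
  · intro k hk
    have := H.factR k hk
    try simp only [Pi.zero_apply]
    split_ifs <;> omega
  · intro i hi k hk
    have := H.factR i hi
    have := H.factR k hk
    split_ifs <;> omega

lemma p32_1_eq (n : ℕ) (f : ℕ → ℕ) : p32_1 n f = ∑ i ∈ range n, ∑ k ∈ range n,
    if i + 1 < k ∧ f k < f (i + 1) ∧ f (i + 1) < f i then 1 else 0 :=
  card_pairs n (fun i k => i + 1 < k ∧ f k < f (i + 1) ∧ f (i + 1) < f i)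

lemma p32_1_glue (H : Glued a b f g h) :
    p32_1 (a + 1 + b) h = p32_1 a f + p32_1 b g + (∑ k ∈ range b, (if 0 < k ∧ g k < g 0 then 1 else 0)) := by
  have hM := H.factM
  rw [p32_1_eq, blocks a b _
    (fun i k => if i + 1 < k ∧ f k < f (i + 1) ∧ f (i + 1) < f i then 1 else 0)
    (fun i k => if i + 1 < k ∧ g k < g (i + 1) ∧ g (i + 1) < g i then 1 else 0)
    0
    0
    (fun k => if 0 < k ∧ g k < g 0 then 1 else 0)
    (fun i k hik => if_neg (by omega)) ?_ ?_ ?_ ?_ ?_, ← p32_1_eq, ← p32_1_eq]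
  · simp
  · intro i hi k hk
    have := H.factL i hi
    have := H.factL k hk
    split_ifs <;> omega
  · intro i hi
    have := H.factL i hi
    try simp only [Pi.zero_apply]
    split_ifs <;> omega
  · intro i hi k hk
    have := H.factL i hi
    have := H.factR k hk
    try simp only [Pi.zero_apply]
    split_ifs <;> omega
  · intro k hk
    have := H.factR k hk
    try simp only [Pi.zero_apply]
    split_ifs <;> omega
  · intro i hi k hk
    have := H.factR i hi
    have := H.factR k hk
    split_ifs <;> omega

lemma p21_3_eq (n : ℕ) (f : ℕ → ℕ) : p21_3 n f = ∑ i ∈ range n, ∑ k ∈ range n,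
    if i + 1 < k ∧ f (i + 1) < f i ∧ f i < f k then 1 else 0 :=
  card_pairs n (fun i k => i + 1 < k ∧ f (i + 1) < f i ∧ f i < f k)

lemma p21_3_glue (H : Glued a b f g h) :
    p21_3 (a + 1 + b) h = p21_3 a f + p21_3 b g + ((b + 1) * des a f) := by
  have hM := H.factM
  rw [p21_3_eq, blocks a b _
    (fun i k => if i + 1 < k ∧ f (i + 1) < f i ∧ f i < f k then 1 else 0)
    (fun i k => if i + 1 < k ∧ g (i + 1) < g i ∧ g i < g k then 1 else 0)
    (fun i _ => if i + 1 < a ∧ f (i + 1) < f i then 1 else 0)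
    (fun k => if k + 1 < a ∧ f (k + 1) < f k then 1 else 0)
    0
    (fun i k hik => if_neg (by omega)) ?_ ?_ ?_ ?_ ?_, ← p21_3_eq, ← p21_3_eq]
  · simp only [des_eq, Finset.sum_const, card_range, smul_eq_mul, Pi.zero_apply, ← Finset.mul_sum]
    ring
  · intro i hi k hk
    have := H.factL i hi
    have := H.factL k hk
    split_ifs <;> omega
  · intro i hi
    have := H.factL i hi
    try simp only [Pi.zero_apply]
    split_ifs <;> omega
  · intro i hi k hk
    have := H.factL i hi
    have := H.factR k hk
    try simp only [Pi.zero_apply]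
    split_ifs <;> omega
  · intro k hk
    have := H.factR k hk
    try simp only [Pi.zero_apply]
    split_ifs <;> omega
  · intro i hi k hk
    have := H.factR i hi
    have := H.factR k hk
    split_ifs <;> omega

lemma p3_21_eq (n : ℕ) (f : ℕ → ℕ) : p3_21 n f = ∑ i ∈ range n, ∑ k ∈ range n,
    if i < k ∧ k + 1 < n ∧ f (k + 1) < f k ∧ f k < f i then 1 else 0 :=
  card_pairs n (fun i k => i < k ∧ k + 1 < n ∧ f (k + 1) < f k ∧ f k < f i)

lemma p3_21_glue (H : Glued a b f g h) :
    p3_21 (a + 1 + b) h = p3_21 a f + p3_21 b g + (des b g) := by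
  have hM := H.factM
  rw [p3_21_eq, blocks a b _
    (fun i k => if i < k ∧ k + 1 < a ∧ f (k + 1) < f k ∧ f k < f i then 1 else 0)
    (fun i k => if i < k ∧ k + 1 < b ∧ g (k + 1) < g k ∧ g k < g i then 1 else 0)
    0
    0
    (fun k => if k + 1 < b ∧ g (k + 1) < g k then 1 else 0)
    (fun i k hik => if_neg (by omega)) ?_ ?_ ?_ ?_ ?_, ← p3_21_eq, ← p3_21_eq]
  · simp [des_eq]
  · intro i hi k hk
    have := H.factL i hi
    have := H.factL k hk
    split_ifs <;> omega
  · intro i hi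
    have := H.factL i hi
    try simp only [Pi.zero_apply]
    split_ifs <;> omega
  · intro i hi k hk
    have := H.factL i hi
    have := H.factR k hk
    try simp only [Pi.zero_apply]
    split_ifs <;> omega
  · intro k hk
    have := H.factR k hk
    try simp only [Pi.zero_apply]
    split_ifs <;> omega
  · intro i hi k hk
    have := H.factR i hi
    have := H.factR k hk
    split_ifs <;> omega

lemma p13_2_eq (n : ℕ) (f : ℕ → ℕ) : p13_2 n f = ∑ i ∈ range n, ∑ k ∈ range n,
    if i + 1 < k ∧ f i < f k ∧ f k < f (i + 1) then 1 else 0 :=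
  card_pairs n (fun i k => i + 1 < k ∧ f i < f k ∧ f k < f (i + 1))

lemma p13_2_glue (H : Glued a b f g h) :
    p13_2 (a + 1 + b) h = p13_2 a f + p13_2 b g + ((if a = 0 then 0 else b)) := by
  have hM := H.factM
  rw [p13_2_eq, blocks a b _
    (fun i k => if i + 1 < k ∧ f i < f k ∧ f k < f (i + 1) then 1 else 0)
    (fun i k => if i + 1 < k ∧ g i < g k ∧ g k < g (i + 1) then 1 else 0)
    (fun i _ => if i + 1 = a then 1 else 0)
    0
    0
    (fun i k hik => if_neg (by omega)) ?_ ?_ ?_ ?_ ?_, ← p13_2_eq, ← p13_2_eq]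
  · simp only [Finset.sum_const, card_range, smul_eq_mul, Pi.zero_apply, ← Finset.mul_sum]
    cases a with
    | zero => simp
    | succ m =>
      rw [Finset.sum_eq_single m (fun i _ hi => if_neg (by omega)) (by simp)]
      simp
  · intro i hi k hk
    have := H.factL i hi
    have := H.factL k hk
    split_ifs <;> omega
  · intro i hi
    have := H.factL i hi
    try simp only [Pi.zero_apply]
    split_ifs <;> omega
  · intro i hi k hk
    have := H.factL i hi
    have := H.factR k hk
    try simp only [Pi.zero_apply]
    split_ifs <;> omega
  · intro k hk
    have := H.factR k hk
    try simp only [Pi.zero_apply]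
    split_ifs <;> omega
  · intro i hi k hk
    have := H.factR i hi
    have := H.factR k hk
    split_ifs <;> omega

lemma mak_glue (H : Glued a b f g h) (hg : ∀ i < b, ∀ j < b, g i = g j → i = j) :
    mak (a + 1 + b) h = mak a f + mak b g + a * des b g + (if b = 0 then 0 else a + b) := by
  have key : ∑ k ∈ range b, (if 0 < k ∧ g 0 < g k then 1 else 0) +
      ∑ k ∈ range b, (if 0 < k ∧ g k < g 0 then 1 else 0) = b - 1 := by
    rw [← Finset.sum_add_distrib]
    cases b with
    | zero => simp
    | succ m =>
      rw [Finset.sum_range_succ', Finset.sum_congr rfl (g := fun _ => 1)]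
      · simp
      · intro i hi
        have := hg 0 (by omega) (i + 1) (by have := mem_range.1 hi; omega)
        split_ifs <;> omega
  unfold mak
  rw [p1_32_glue H, p31_2_glue H, p32_1_glue H, des_glue H]
  split_ifs at * <;> omega

lemma foze_glue (H : Glued a b f g h) :
    foze6 (a + 1 + b) h = foze6 a f + foze6 b g + (b + 1) * des a f + des b g +
      (if a = 0 then 0 else b) + (if b = 0 then 0 else 1) := by
  unfold foze6
  rw [p21_3_glue H, p3_21_glue H, p13_2_glue H, des_glue H]
  ring

end stats

section trees

/-- Value sequences of 231-avoiding permutations of `{1,…,n}`. -/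
structure InS (n : ℕ) (f : ℕ → ℕ) : Prop where
  zero : ∀ i, n ≤ i → f i = 0
  bd : ∀ i < n, 1 ≤ f i ∧ f i ≤ n
  inj : ∀ i < n, ∀ j < n, f i = f j → i = j
  av : Av231 n f

def glue (a b : ℕ) (f g : ℕ → ℕ) : ℕ → ℕ := fun i =>
  if i < a then f i else if i = a then a + b + 1 else
    if i < a + 1 + b then g (i - (a + 1)) + a else 0

lemma glued_glue {a b : ℕ} {f g : ℕ → ℕ} (hf : InS a f) (hg : InS b g) :
    Glued a b f g (glue a b f g) where
  hL i hi := by simp [glue, hi]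
  hM := by simp [glue]
  hR i hi := by
    unfold glue
    rw [if_neg (by omega), if_neg (by omega), if_pos (by omega)]
    congr 2
    omega
  fb := hf.bd
  gb := hg.bd

lemma Glued.cases {a b : ℕ} {f g h : ℕ → ℕ} (H : Glued a b f g h) (i : ℕ) (hi : i < a + 1 + b) :
    (i < a ∧ h i = f i ∧ 1 ≤ f i ∧ f i ≤ a) ∨ (i = a ∧ h i = a + b + 1) ∨
      ∃ j, j < b ∧ i = a + 1 + j ∧ h i = g j + a ∧ 1 ≤ g j ∧ g j ≤ b := by
  by_cases h1 : i < a
  · exact Or.inl ⟨h1, H.hL i h1, H.fb i h1⟩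
  · by_cases h2 : i = a
    · exact Or.inr (Or.inl ⟨h2, h2 ▸ H.hM⟩)
    · obtain ⟨j, rfl⟩ : ∃ j, i = a + 1 + j := ⟨i - (a + 1), by omega⟩
      have hj : j < b := by omega
      exact Or.inr (Or.inr ⟨j, hj, rfl, H.hR j hj, H.gb j hj⟩)

lemma glue_inS {a b : ℕ} {f g : ℕ → ℕ} (hf : InS a f) (hg : InS b g) :
    InS (a + 1 + b) (glue a b f g) := by
  have H := glued_glue hf hg
  refine ⟨?_, ?_, ?_, ?_⟩
  · intro i hi
    unfold glue
    rw [if_neg (by omega), if_neg (by omega), if_neg (by omega)]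
  · intro i hi
    rcases H.cases i hi with h | h | ⟨j, h⟩ <;> omega
  · intro i hi j hj hij
    rcases H.cases i hi with h | h | ⟨i', h⟩ <;> rcases H.cases j hj with h' | h' | ⟨j', h'⟩ <;>
      try omega
    · exact hf.inj i h.1 j h'.1 (by omega)
    · have := hg.inj i' h.1 j' h'.1 (by omega)
      omega
  · rintro ⟨i, j, k, hij, hjk, hk, h1, h2⟩
    rcases H.cases i (by omega) with h | h | ⟨i', h⟩ <;>
      rcases H.cases j (by omega) with h' | h' | ⟨j', h'⟩ <;>
      rcases H.cases k (by omega) with h'' | h'' | ⟨k', h''⟩ <;> try omega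
    · exact hf.av ⟨i, j, k, hij, hjk, h''.1, by omega, by omega⟩
    · exact hg.av ⟨i', j', k', by omega, by omega, h''.1, by omega, by omega⟩

def word : BinaryTree Unit → ℕ → ℕ
  | .nil => fun _ => 0
  | .node _ L R => glue L.numNodes R.numNodes (word L) (word R)

lemma numNodes_node (L R : BinaryTree Unit) :
    (BinaryTree.node () L R).numNodes = L.numNodes + 1 + R.numNodes := by
  simp only [BinaryTree.numNodes]
  omega

lemma word_inS (T : BinaryTree Unit) : InS T.numNodes (word T) := by
  induction T with
  | nil =>
    refine ⟨fun _ _ => rfl, ?_, ?_, ?_⟩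
    · intro i hi
      simp [BinaryTree.numNodes] at hi
    · intro i hi
      simp [BinaryTree.numNodes] at hi
    · rintro ⟨i, j, k, _, _, hk, _⟩
      simp [BinaryTree.numNodes] at hk
  | node u L R hL hR =>
    rw [numNodes_node]
    exact glue_inS hL hR

lemma word_inj (T : BinaryTree Unit) : ∀ T' : BinaryTree Unit, T.numNodes = T'.numNodes →
    word T = word T' → T = T' := by
  induction T with
  | nil =>
    intro T' h _
    cases T' with
    | nil => rfl
    | node u L R => rw [numNodes_node] at h; simp [BinaryTree.numNodes] at h <;> omega
  | node u L R hL hR =>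
    intro T' h hw
    cases T' with
    | nil => rw [numNodes_node] at h; simp [BinaryTree.numNodes] at h
    | node u' L' R' =>
      rw [numNodes_node, numNodes_node] at h
      have G := glued_glue (word_inS L) (word_inS R)
      have G' := glued_glue (word_inS L') (word_inS R')
      have I' := glue_inS (word_inS L') (word_inS R')
      change glue _ _ _ _ = glue _ _ _ _ at hw
      rw [hw] at G
      have ha : L.numNodes = L'.numNodes := by
        apply I'.inj _ (by omega) _ (by omega)
        rw [G.hM, G'.hM]
        omega
      have hb : R.numNodes = R'.numNodes := by omega
      have e1 : word L = word L' := by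
        funext i
        by_cases hi : i < L.numNodes
        · rw [← G.hL i hi, ← G'.hL i (by omega)]
        · rw [(word_inS L).zero i (by omega), (word_inS L').zero i (by omega)]
      have e2 : word R = word R' := by
        funext i
        by_cases hi : i < R.numNodes
        · have x := G.hR i hi
          have y := G'.hR i (by omega)
          rw [ha] at x
          omega
        · rw [(word_inS R).zero i (by omega), (word_inS R').zero i (by omega)]
      rw [hL L' ha e1, hR R' hb e2]

lemma exists_max {n : ℕ} {f : ℕ → ℕ} (hf : InS (n + 1) f) : ∃ a < n + 1, f a = n + 1 := by
  by_contra hcon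
  push Not at hcon
  have := Finset.card_le_card_of_injOn (s := range (n + 1)) (t := Finset.Icc 1 n) f
    (by
      intro i hi
      have hi' : i < n + 1 := by simpa using hi
      have := hf.bd i hi'
      have := hcon i hi'
      simp
      omega)
    (by
      intro i hi j hj hij
      exact hf.inj i (by simpa using hi) j (by simpa using hj) hij)
  simp at this

lemma word_surj (n : ℕ) : ∀ f, InS n f → ∃ T : BinaryTree Unit, T.numNodes = n ∧ word T = f := by
  induction n using Nat.strong_induction_on with
  | _ n ih =>
  intro h hh
  cases n with
  | zero =>
    refine ⟨.nil, rfl, ?_⟩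
    funext i
    exact (hh.zero i (Nat.zero_le _)).symm
  | succ n =>
    obtain ⟨a, ha, hmax⟩ := exists_max hh
    obtain ⟨b, rfl⟩ : ∃ b, n = a + b := ⟨n - a, by omega⟩
    have ne : ∀ i, i < a + b + 1 → i ≠ a → h i ≤ a + b := by
      intro i hi hia
      have h1 := hh.bd i hi
      have : h i ≠ h a := fun e => hia (hh.inj i hi a ha e)
      omega
    have lt : ∀ i < a, ∀ k < b, h i < h (a + 1 + k) := by
      intro i hi k hk
      by_contra hcon
      have h1 := ne i (by omega) (by omega)
      have h2 : h i ≠ h (a + 1 + k) := fun e => by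
        have := hh.inj i (by omega) (a + 1 + k) (by omega) e
        omega
      exact hh.av ⟨i, a, a + 1 + k, hi, by omega, by omega, by omega, by omega⟩
    have hLb : ∀ i < a, h i ≤ a := by
      intro i hi
      have := Finset.card_le_card_of_injOn (s := range b) (t := Finset.Icc (h i + 1) (a + b))
        (fun k => h (a + 1 + k))
        (by
          intro k hk
          have hk' : k < b := by simpa using hk
          have h1 := lt i hi k hk'
          have h2 := ne (a + 1 + k) (by omega) (by omega)
          simp
          omega)
        (by
          intro k hk k' hk' e
          have hk1 : k < b := by simpa using hk
          have hk2 : k' < b := by simpa using hk'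
          have := hh.inj (a + 1 + k) (by omega) (a + 1 + k') (by omega) e
          omega)
      have h2 := ne i (by omega) (by omega)
      simp at this
      omega
    have hRb : ∀ k < b, a + 1 ≤ h (a + 1 + k) := by
      intro k hk
      have := Finset.card_le_card_of_injOn (s := range a) (t := Finset.Ico 1 (h (a + 1 + k))) h
        (by
          intro i hi
          have hi' : i < a := by simpa using hi
          have h1 := lt i hi' k hk
          have h2 := hh.bd i (by omega)
          simp
          omega)
        (by
          intro i hi j hj e
          have hi1 : i < a := by simpa using hi
          have hj1 : j < a := by simpa using hj
          exact hh.inj i (by omega) j (by omega) e)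
      have h2 := hh.bd (a + 1 + k) (by omega)
      simp at this
      omega
    have If : InS a (fun i => if i < a then h i else 0) := by
      refine ⟨fun i hi => if_neg (by omega), ?_, ?_, ?_⟩
      · intro i hi
        simp only [if_pos hi]
        exact ⟨(hh.bd i (by omega)).1, hLb i hi⟩
      · intro i hi j hj e
        simp only [if_pos hi, if_pos hj] at e
        exact hh.inj i (by omega) j (by omega) e
      · rintro ⟨i, j, k, hij, hjk, hk, h1, h2⟩
        have hj : j < a := by omega
        have hi : i < a := by omega
        simp only [if_pos hi, if_pos hj, if_pos hk] at h1 h2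
        exact hh.av ⟨i, j, k, hij, hjk, by omega, h1, h2⟩
    have Ig : InS b (fun i => if i < b then h (a + 1 + i) - a else 0) := by
      refine ⟨fun i hi => if_neg (by omega), ?_, ?_, ?_⟩
      · intro i hi
        simp only [if_pos hi]
        have := hRb i hi
        have := ne (a + 1 + i) (by omega) (by omega)
        omega
      · intro i hi j hj e
        simp only [if_pos hi, if_pos hj] at e
        have := hRb i hi
        have := hRb j hj
        have := hh.inj (a + 1 + i) (by omega) (a + 1 + j) (by omega) (by omega)
        omega
      · rintro ⟨i, j, k, hij, hjk, hk, h1, h2⟩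
        have hj : j < b := by omega
        have hi : i < b := by omega
        simp only [if_pos hi, if_pos hj, if_pos hk] at h1 h2
        exact hh.av ⟨a + 1 + i, a + 1 + j, a + 1 + k, by omega, by omega, by omega,
          by omega, by omega⟩
    obtain ⟨L, hL1, hL2⟩ := ih a (by omega) _ If
    obtain ⟨R, hR1, hR2⟩ := ih b (by omega) _ Ig
    refine ⟨.node () L R, by rw [numNodes_node]; omega, ?_⟩
    change glue _ _ _ _ = h
    rw [hL1, hR1, hL2, hR2]
    funext i
    unfold glue
    by_cases c1 : i < a
    · simp [c1]
    · by_cases c2 : i = a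
      · subst c2
        simp [hmax]
      · by_cases c3 : i < a + 1 + b
        · obtain ⟨j, rfl⟩ : ∃ j, i = a + 1 + j := ⟨i - (a + 1), by omega⟩
          have hj : j < b := by omega
          have := hRb j hj
          rw [if_neg c1, if_neg c2, if_pos c3, Nat.add_sub_cancel_left]
          simp only [if_pos hj]
          omega
        · rw [if_neg c1, if_neg c2, if_neg c3, hh.zero i (by omega)]

lemma pf_lt {n : ℕ} (σ : Equiv.Perm (Fin n)) (i : ℕ) (hi : i < n) :
    pf σ i = (σ ⟨i, hi⟩ : ℕ) + 1 := by
  simp [pf, hi]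

lemma pf_inS {n : ℕ} (σ : Equiv.Perm (Fin n)) (h : Av231 n (pf σ)) : InS n (pf σ) := by
  refine ⟨?_, ?_, ?_, h⟩
  · intro i hi
    unfold pf
    rw [dif_neg (by omega)]
  · intro i hi
    rw [pf_lt σ i hi]
    omega
  · intro i hi j hj e
    rw [pf_lt σ i hi, pf_lt σ j hj] at e
    have := σ.injective (Fin.ext (by omega : (σ ⟨i, hi⟩ : ℕ) = σ ⟨j, hj⟩))
    simpa using this

lemma pf_injective {n : ℕ} : Function.Injective (pf (n := n)) := by
  intro σ τ h
  ext ⟨i, hi⟩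
  have := congrFun h i
  rw [pf_lt _ i hi, pf_lt _ i hi] at this
  omega

lemma pf_surj {n : ℕ} (f : ℕ → ℕ) (hf : InS n f) : ∃ σ : Equiv.Perm (Fin n), pf σ = f := by
  let F : Fin n → Fin n := fun i => ⟨f i - 1, by have := hf.bd i i.2; omega⟩
  have hF : Function.Injective F := by
    intro i j e
    have e' : f i - 1 = f j - 1 := congrArg Fin.val e
    have h1 := hf.bd i i.2
    have h2 := hf.bd j j.2
    exact Fin.ext (hf.inj i i.2 j j.2 (by omega))
  refine ⟨Equiv.ofBijective F (Finite.injective_iff_bijective.1 hF), ?_⟩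
  funext i
  by_cases hi : i < n
  · rw [pf_lt _ i hi]
    have h1 := hf.bd i hi
    change f i - 1 + 1 = f i
    omega
  · rw [hf.zero i (by omega)]
    unfold pf
    rw [dif_neg hi]

open BinaryTree in
lemma ncard_eq (n : ℕ) (P : (ℕ → ℕ) → Prop) [DecidablePred fun T => P (word T)] :
    Set.ncard {σ : Equiv.Perm (Fin n) | Av231 n (pf σ) ∧ P (pf σ)} =
      ((treesOfNumNodesEq n).filter fun T => P (word T)).card := by
  rw [← Set.ncard_image_of_injective _ pf_injective, ← Set.ncard_coe_finset,
    ← Set.ncard_image_of_injOn (f := word) (s := (((treesOfNumNodesEq n).filter fun T => P (word T) :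
      Finset (BinaryTree Unit)) : Set (BinaryTree Unit)))]
  · congr 1
    ext f
    constructor
    · rintro ⟨σ, ⟨h1, h2⟩, rfl⟩
      obtain ⟨T, hT, hw⟩ := word_surj n _ (pf_inS σ h1)
      refine ⟨T, ?_, hw⟩
      simp [mem_treesOfNumNodesEq, hT, hw, h2]
    · rintro ⟨T, hT, rfl⟩
      simp [mem_treesOfNumNodesEq] at hT
      obtain ⟨rfl, hP⟩ := hT
      obtain ⟨σ, hσ⟩ := pf_surj _ (word_inS T)
      refine ⟨σ, ⟨?_, ?_⟩, hσ⟩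
      · rw [hσ]; exact (word_inS T).av
      · rw [hσ]; exact hP
  · intro T hT T' hT' e
    simp [mem_treesOfNumNodesEq] at hT hT'
    exact word_inj T T' (hT.1.trans hT'.1.symm) e

open BinaryTree in
lemma sum_trees_succ {R : Type*} [CommSemiring R] (n : ℕ) (F : BinaryTree Unit → R) :
    ∑ T ∈ treesOfNumNodesEq (n + 1), F T = ∑ p ∈ HasAntidiagonal.antidiagonal n,
      ∑ L ∈ treesOfNumNodesEq p.1, ∑ R ∈ treesOfNumNodesEq p.2, F (.node () L R) := by
  rw [treesOfNumNodesEq_succ, Finset.sum_biUnion]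
  · refine Finset.sum_congr rfl fun p hp => ?_
    unfold pairwiseNode
    rw [Finset.sum_map, Finset.sum_product]
    rfl
  · intro p hp p' hp' hne
    rw [Function.onFun, Finset.disjoint_left]
    intro T hT hT'
    apply hne
    cases T with
    | nil => simp [pairwiseNode] at hT
    | node u L R =>
      simp only [pairwiseNode, Finset.mem_map, Finset.mem_product, mem_treesOfNumNodesEq,
        Prod.exists, Function.Embedding.coeFn_mk, BinaryTree.node.injEq] at hT hT'
      obtain ⟨x, y, ⟨h1, h2⟩, -, rfl, rfl⟩ := hT
      obtain ⟨x', y', ⟨h1', h2'⟩, -, rfl, rfl⟩ := hT'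
      exact Prod.ext (h1.symm.trans h1') (h2.symm.trans h2')

def mk (T : BinaryTree Unit) : ℕ := mak T.numNodes (word T)
def fz (T : BinaryTree Unit) : ℕ := foze6 T.numNodes (word T)
def ds (T : BinaryTree Unit) : ℕ := des T.numNodes (word T)

lemma ds_node (L R : BinaryTree Unit) : ds (.node () L R) =
    ds L + ds R + (if R.numNodes = 0 then 0 else 1) := by
  unfold ds
  rw [numNodes_node]
  exact des_glue (glued_glue (word_inS L) (word_inS R))

lemma mk_node (L R : BinaryTree Unit) : mk (.node () L R) =
    mk L + mk R + L.numNodes * ds R +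
      (if R.numNodes = 0 then 0 else L.numNodes + R.numNodes) := by
  unfold ds mk
  rw [numNodes_node]
  exact mak_glue (glued_glue (word_inS L) (word_inS R)) (word_inS R).inj

lemma fz_node (L R : BinaryTree Unit) : fz (.node () L R) =
    fz L + fz R + (R.numNodes + 1) * ds L + ds R +
      (if L.numNodes = 0 then 0 else R.numNodes) + (if R.numNodes = 0 then 0 else 1) := by
  unfold ds fz
  rw [numNodes_node]
  exact foze_glue (glued_glue (word_inS L) (word_inS R))

open BinaryTree in
lemma gf_eq {R : Type*} [CommSemiring R] (q t : R) (n : ℕ) :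
    ∑ T ∈ treesOfNumNodesEq n, q ^ mk T * t ^ ds T =
      ∑ T ∈ treesOfNumNodesEq n, q ^ fz T * t ^ ds T := by
  have := rec_unique q t
    (fun n e => ∑ T ∈ treesOfNumNodesEq n, q ^ mk T * (t * q ^ e) ^ ds T)
    (fun n e => ∑ T ∈ treesOfNumNodesEq n, q ^ fz T * (t * q ^ e) ^ ds T)
    (by
      intro e
      simp [treesOfNumNodesEq_zero, mk, ds, BinaryTree.numNodes, mak, des, desSet,
        p1_32, p31_2, p32_1])
    (by
      intro e
      simp [treesOfNumNodesEq_zero, fz, ds, BinaryTree.numNodes, foze6, des, desSet,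
        p21_3, p3_21, p13_2])
    (by
      intro n e
      rw [sum_trees_succ]
      refine Finset.sum_congr rfl fun p hp => ?_
      rw [HasAntidiagonal.mem_antidiagonal] at hp
      rw [Finset.mul_sum, Finset.sum_mul_sum]
      refine Finset.sum_congr rfl fun L hL => Finset.sum_congr rfl fun S hS => ?_
      rw [mem_treesOfNumNodesEq] at hL hS
      rw [mk_node, ds_node, hL, hS, ← hp]
      unfold wt
      split_ifs <;> ring)
    (by
      intro n e
      rw [sum_trees_succ]
      refine Finset.sum_congr rfl fun p hp => ?_
      rw [HasAntidiagonal.mem_antidiagonal] at hp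
      rw [mul_assoc, Finset.sum_mul_sum, Finset.mul_sum]
      simp only [Finset.mul_sum]
      refine Finset.sum_congr rfl fun L hL => Finset.sum_congr rfl fun S hS => ?_
      rw [mem_treesOfNumNodesEq] at hL hS
      rw [fz_node, ds_node, hL, hS]
      unfold wt
      split_ifs <;> ring) n 0
  simpa using this

open BinaryTree Polynomial in
lemma coeff_gf (s : Finset (BinaryTree Unit)) (u v : BinaryTree Unit → ℕ) (k l : ℕ) :
    ((∑ T ∈ s, (C (X : ℕ[X]) : ℕ[X][X]) ^ u T * X ^ v T).coeff l).coeff k =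
      (s.filter fun T => u T = k ∧ v T = l).card := by
  rw [Finset.card_filter, finsetSum_coeff, finsetSum_coeff]
  refine Finset.sum_congr rfl fun T _ => ?_
  rw [← C_pow, coeff_C_mul, coeff_X_pow]
  by_cases h1 : l = v T
  · simp [h1, coeff_X_pow, eq_comm]
  · simp [h1, Ne.symm h1]

end trees

/-- over `S_n(231)`, `mak` and `(21-3)+(3-21)+(13-2)+des` are jointly
equidistributed with `des`. -/
theorem stmt8 (n : ℕ) (hn : 1 ≤ n) (k l : ℕ) :
    Set.ncard {σ : Equiv.Perm (Fin n) |
        Av231 n (pf σ) ∧ mak n (pf σ) = k ∧ des n (pf σ) = l} =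
    Set.ncard {σ : Equiv.Perm (Fin n) |
        Av231 n (pf σ) ∧ foze6 n (pf σ) = k ∧ des n (pf σ) = l} := by
  rw [ncard_eq n (fun f => mak n f = k ∧ des n f = l),
    ncard_eq n (fun f => foze6 n f = k ∧ des n f = l)]
  have h := congrArg (fun P => (Polynomial.coeff P l).coeff k)
    (gf_eq (Polynomial.C (Polynomial.X : Polynomial ℕ)) Polynomial.X n)
  simp only [coeff_gf] at h
  have e1 : ∀ T ∈ BinaryTree.treesOfNumNodesEq n,
      ((mak n (word T) = k ∧ des n (word T) = l) ↔ (mk T = k ∧ ds T = l)) := by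
    intro T hT
    rw [BinaryTree.mem_treesOfNumNodesEq] at hT
    unfold mk ds
    rw [hT]
  have e2 : ∀ T ∈ BinaryTree.treesOfNumNodesEq n,
      ((foze6 n (word T) = k ∧ des n (word T) = l) ↔ (fz T = k ∧ ds T = l)) := by
    intro T hT
    rw [BinaryTree.mem_treesOfNumNodesEq] at hT
    unfold fz ds
    rw [hT]
  rw [Finset.filter_congr e1, Finset.filter_congr e2]
  exact h

end MahonianStats
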